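/- Let s ∈ (0,1) and let p be a uniformly continuous symmetric function on ℝ^N×ℝ^N with 1 < p⁻ := inf p ≤ p⁺ := sup p < ∞ and s·p⁺ < N. Then for every continuous r on ℝ^N with 1 < inf r ≤ sup r < ∞ and r(x) < p*_s(x) := N p(x,x)/(N − s p(x,x)) for all x ∈ ℝ^N, the embedding of W^{s,p(·,·)}(ℝ^N) into L^{r(·)}_loc(ℝ^N) is compact: for every ball B ⊂ ℝ^N, every sequence bounded in the norm ‖·‖_{s,p,ℝ^N} has a subsequence whose restrictions to B converge in the norm ‖·‖_{L^{r(·)}(B)}. -/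

import Mathlib

open MeasureTheory Metric Set Filter
open scoped ENNReal NNReal

noncomputable section

/-- `Ω` is a (bounded or unbounded) Lipschitz domain in `ℝ^N`: it is open, nonempty, and near
every boundary point, after a rigid motion (an isometry of `ℝ^N`), `Ω` coincides with the strict
epigraph of a Lipschitz function of the first `N-1` coordinates. -/
def IsLipschitzDomain {N : ℕ} (Ω : Set (EuclideanSpace ℝ (Fin N))) : Prop :=
  IsOpen Ω ∧ Ω.Nonempty ∧
    ∀ z ∈ frontier Ω, ∃ r : ℝ, 0 < r ∧
      ∃ e : EuclideanSpace ℝ (Fin N) ≃ᵢ EuclideanSpace ℝ (Fin N),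
        ∃ L : NNReal, ∃ φ : EuclideanSpace ℝ (Fin N) → ℝ, LipschitzWith L φ ∧
          (∀ x y : EuclideanSpace ℝ (Fin N),
            (∀ i : Fin N, (i : ℕ) + 1 < N → x i = y i) → φ x = φ y) ∧
          ∀ hN : 0 < N, ∀ x ∈ Metric.ball z r,
            (x ∈ Ω ↔ φ (e x) < (e x) ⟨N - 1, Nat.sub_lt hN Nat.one_pos⟩)

/-- The modular `∫_Ω |u(x)|^{q(x)} dx` of the variable exponent Lebesgue space `L^{q(·)}(Ω)`. -/
def modLq {N : ℕ} (Ω : Set (EuclideanSpace ℝ (Fin N))) (q : EuclideanSpace ℝ (Fin N) → ℝ)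
    (u : EuclideanSpace ℝ (Fin N) → ℝ) : ℝ≥0∞ :=
  ∫⁻ x in Ω, ENNReal.ofReal (|u x| ^ q x)

/-- The Luxemburg norm `‖u‖_{L^{q(·)}(Ω)} = inf {λ > 0 : ∫_Ω |u(x)/λ|^{q(x)} dx ≤ 1}`. -/
def luxNorm {N : ℕ} (Ω : Set (EuclideanSpace ℝ (Fin N))) (q : EuclideanSpace ℝ (Fin N) → ℝ)
    (u : EuclideanSpace ℝ (Fin N) → ℝ) : ℝ :=
  sInf {l : ℝ | 0 < l ∧ modLq Ω q (fun x => u x / l) ≤ 1}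

/-- The Gagliardo modular
`∫_Ω ∫_Ω |u(x)-u(y)|^{p(x,y)} / |x-y|^{N+s·p(x,y)} dx dy` with variable exponent `p`. -/
def gagMod {N : ℕ} (Ω : Set (EuclideanSpace ℝ (Fin N))) (s : ℝ)
    (p : EuclideanSpace ℝ (Fin N) → EuclideanSpace ℝ (Fin N) → ℝ)
    (u : EuclideanSpace ℝ (Fin N) → ℝ) : ℝ≥0∞ :=
  ∫⁻ x in Ω, ∫⁻ y in Ω,
    ENNReal.ofReal (|u x - u y| ^ p x y / ‖x - y‖ ^ ((N : ℝ) + s * p x y))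

/-- The Gagliardo seminorm
`[u]_{s,p(·,·),Ω} = inf {λ > 0 : ∫_Ω ∫_Ω |u(x)-u(y)|^{p(x,y)}/(λ^{p(x,y)}|x-y|^{N+s p(x,y)}) < 1}`. -/
def gagSeminorm {N : ℕ} (Ω : Set (EuclideanSpace ℝ (Fin N))) (s : ℝ)
    (p : EuclideanSpace ℝ (Fin N) → EuclideanSpace ℝ (Fin N) → ℝ)
    (u : EuclideanSpace ℝ (Fin N) → ℝ) : ℝ :=
  sInf {l : ℝ | 0 < l ∧ gagMod Ω s p (fun x => u x / l) < 1}

/-- The norm `‖u‖_{s,q,p,Ω} = ‖u‖_{L^{q(·)}(Ω)} + [u]_{s,p(·,·),Ω}` of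
`W^{s,q(·),p(·,·)}(Ω)`. -/
def sobNorm {N : ℕ} (Ω : Set (EuclideanSpace ℝ (Fin N))) (q : EuclideanSpace ℝ (Fin N) → ℝ)
    (s : ℝ) (p : EuclideanSpace ℝ (Fin N) → EuclideanSpace ℝ (Fin N) → ℝ)
    (u : EuclideanSpace ℝ (Fin N) → ℝ) : ℝ :=
  luxNorm Ω q u + gagSeminorm Ω s p u

/-- Membership in `W^{s,q(·),p(·,·)}(Ω)`: `u` is measurable, lies in `L^{q(·)}(Ω)`, and its
Gagliardo modular is finite. -/
def memW {N : ℕ} (Ω : Set (EuclideanSpace ℝ (Fin N))) (q : EuclideanSpace ℝ (Fin N) → ℝ)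
    (s : ℝ) (p : EuclideanSpace ℝ (Fin N) → EuclideanSpace ℝ (Fin N) → ℝ)
    (u : EuclideanSpace ℝ (Fin N) → ℝ) : Prop :=
  Measurable u ∧ modLq Ω q u < ⊤ ∧ gagMod Ω s p u < ⊤

lemma rpow_le_one_add_rpow {w t P : ℝ} (hw : 0 ≤ w) (ht : 0 ≤ t) (htP : t ≤ P) :
    w ^ t ≤ 1 + w ^ P := by
  rcases le_total w 1 with h | h
  · have := Real.rpow_le_one hw h ht
    have := Real.rpow_nonneg hw P
    linarith
  · have := Real.rpow_le_rpow_of_exponent_le h htP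
    linarith

/-- A Young-type inequality. -/
lemma le_add_rpow_mul_rpow {t δ p : ℝ} (ht : 0 ≤ t) (hδ : 0 < δ) (hp : 1 ≤ p) :
    t ≤ δ + δ ^ (1 - p) * t ^ p := by
  have h := rpow_le_one_add_rpow (div_nonneg ht hδ.le) zero_le_one hp
  rw [Real.rpow_one, Real.div_rpow ht hδ.le, div_le_iff₀ hδ] at h
  rw [Real.rpow_sub hδ, Real.rpow_one]
  calc t ≤ (1 + t ^ p / δ ^ p) * δ := h
    _ = _ := by ring

lemma rpow_le_add_gagliardo {a H h s t P n : ℝ} (ha : 0 ≤ a) (hH : 0 < H) (hHh : H ≤ h)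
    (hs : 0 ≤ s) (hn : 0 ≤ n) (ht : 0 ≤ t) (htP : t ≤ P) :
    a ^ t ≤ h ^ (s * t) + h ^ (s * t + n) * (a ^ P / H ^ (n + s * P)) := by
  have hHs : 0 < H ^ s := Real.rpow_pos_of_pos hH s
  have h1 := rpow_le_one_add_rpow (div_nonneg ha hHs.le) ht htP
  rw [Real.div_rpow ha hHs.le, Real.div_rpow ha hHs.le, ← Real.rpow_mul hH.le,
    ← Real.rpow_mul hH.le, div_le_iff₀ (Real.rpow_pos_of_pos hH _)] at h1
  have h2 : (1 + a ^ P / H ^ (s * P)) * H ^ (s * t)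
      = H ^ (s * t) + H ^ (s * t + n) * (a ^ P / H ^ (n + s * P)) := by
    rw [Real.rpow_add hH, Real.rpow_add hH]
    have := Real.rpow_pos_of_pos hH n
    have := Real.rpow_pos_of_pos hH (s * P)
    field_simp
  rw [h2] at h1
  refine h1.trans (add_le_add (Real.rpow_le_rpow hH.le hHh (by positivity)) ?_)
  exact mul_le_mul_of_nonneg_right (Real.rpow_le_rpow hH.le hHh (by positivity)) (by positivity)

/-- The integrand of the Gagliardo modular. -/
def gagIntegrand {N : ℕ} (s : ℝ)
    (p : EuclideanSpace ℝ (Fin N) → EuclideanSpace ℝ (Fin N) → ℝ)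
    (u : EuclideanSpace ℝ (Fin N) → ℝ) (x y : EuclideanSpace ℝ (Fin N)) : ℝ :=
  |u x - u y| ^ p x y / ‖x - y‖ ^ ((N : ℝ) + s * p x y)

lemma gagIntegrand_nonneg {N : ℕ} (s : ℝ)
    (p : EuclideanSpace ℝ (Fin N) → EuclideanSpace ℝ (Fin N) → ℝ)
    (u : EuclideanSpace ℝ (Fin N) → ℝ) (x y : EuclideanSpace ℝ (Fin N)) :
    0 ≤ gagIntegrand s p u x y := by
  unfold gagIntegrand; positivity

lemma abs_sub_rpow_le_gagIntegrand {N : ℕ} {s t h : ℝ}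
    {p : EuclideanSpace ℝ (Fin N) → EuclideanSpace ℝ (Fin N) → ℝ}
    (u : EuclideanSpace ℝ (Fin N) → ℝ) {x y : EuclideanSpace ℝ (Fin N)}
    (hs : 0 ≤ s) (ht : 0 < t) (htp : t ≤ p x y) (hxy : dist x y ≤ h) :
    |u x - u y| ^ t ≤ h ^ (s * t) + h ^ (s * t + N) * gagIntegrand s p u x y := by
  have hh : 0 ≤ h := dist_nonneg.trans hxy
  rcases eq_or_ne x y with rfl | hne
  · have := gagIntegrand_nonneg s p u x x
    rw [sub_self, abs_zero, Real.zero_rpow ht.ne']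
    positivity
  · rw [dist_eq_norm] at hxy
    exact rpow_le_add_gagliardo (abs_nonneg _) (norm_pos_iff.2 (sub_ne_zero.2 hne)) hxy hs
      N.cast_nonneg ht.le htp

/-- Integrated form of the pointwise bound, with a free parameter `δ`. -/
lemma lintegral_abs_sub_le_gag {N : ℕ} {s t h δ : ℝ}
    {p : EuclideanSpace ℝ (Fin N) → EuclideanSpace ℝ (Fin N) → ℝ}
    (u : EuclideanSpace ℝ (Fin N) → ℝ) {x : EuclideanSpace ℝ (Fin N)}
    {T : Set (EuclideanSpace ℝ (Fin N))} (hT : MeasurableSet T)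
    (hs : 0 ≤ s) (ht : 1 ≤ t) (hδ : 0 < δ) (hh : 0 ≤ h)
    (htp : ∀ y ∈ T, t ≤ p x y) (hxT : ∀ y ∈ T, dist x y ≤ h) :
    ∫⁻ y in T, ENNReal.ofReal |u x - u y| ≤
      ENNReal.ofReal (δ + δ ^ (1 - t) * h ^ (s * t)) * volume T +
        ENNReal.ofReal (δ ^ (1 - t) * h ^ (s * t + N)) *
          ∫⁻ y in T, ENNReal.ofReal (gagIntegrand s p u x y) := by
  rw [← setLIntegral_const, ← lintegral_const_mul' _ _ ENNReal.ofReal_ne_top,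
    ← lintegral_add_left measurable_const]
  refine setLIntegral_mono' hT fun y hy => ?_
  have hg := gagIntegrand_nonneg s p u x y
  rw [← ENNReal.ofReal_mul (by positivity), ← ENNReal.ofReal_add (by positivity) (by positivity)]
  refine ENNReal.ofReal_le_ofReal ((le_add_rpow_mul_rpow (abs_nonneg _) hδ ht).trans ?_)
  have := mul_le_mul_of_nonneg_left (abs_sub_rpow_le_gagIntegrand u hs (zero_lt_one.trans_le ht)
    (htp y hy) (hxT y hy)) (Real.rpow_nonneg hδ.le (1 - t))
  linarith

/-- The distance of a constant to a mean value is at most the mean distance. -/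
lemma ofReal_abs_sub_average_mul_le {α : Type*} [MeasurableSpace α] {μ : Measure α} {T : Set α}
    (hT0 : μ T ≠ 0) (hT : μ T ≠ ⊤) {u : α → ℝ} (hu : IntegrableOn u T μ) (c : ℝ) :
    ENNReal.ofReal |c - ⨍ y in T, u y ∂μ| * μ T ≤ ∫⁻ y in T, ENNReal.ofReal |c - u y| ∂μ := by
  have hi : IntegrableOn (fun y => c - u y) T μ :=
    Integrable.sub (integrableOn_const hT) hu
  have hc : Integrable (fun _ => c) (μ.restrict T) := integrableOn_const hT
  have h0 : 0 < (μ T).toReal := ENNReal.toReal_pos hT0 hT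
  have h1 : (c - ⨍ y in T, u y ∂μ) * (μ T).toReal = ∫ y in T, (c - u y) ∂μ := by
    rw [integral_sub hc hu, setAverage_eq]
    simp only [integral_const, smul_eq_mul, Measure.real, Measure.restrict_apply_univ]
    field_simp
  rw [← ENNReal.ofReal_toReal hT, ← ENNReal.ofReal_mul (abs_nonneg _), ← abs_of_pos h0, ← abs_mul,
    h1]
  refine (ENNReal.ofReal_le_ofReal abs_integral_le_integral_abs).trans ?_
  rw [ofReal_integral_eq_lintegral_ofReal hi.abs (ae_of_all _ fun _ => abs_nonneg _)]

lemma abs_div_rpow_le {a l q : ℝ} (hl : 1 ≤ l) (hq : 1 ≤ q) : |a / l| ^ q ≤ l⁻¹ * |a| ^ q := by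
  have h0 : 0 < l := zero_lt_one.trans_le hl
  rw [abs_div, abs_of_pos h0, Real.div_rpow (abs_nonneg _) h0.le, div_eq_inv_mul]
  have : l ≤ l ^ q := by simpa using Real.rpow_le_rpow_of_exponent_le hl hq
  gcongr

lemma abs_rpow_le_mul_abs_div_rpow {a l K q P : ℝ} (hl : 0 < l) (hlK : l ≤ K) (hK : 1 ≤ K)
    (hq : 0 ≤ q) (hqP : q ≤ P) : |a| ^ q ≤ K ^ P * |a / l| ^ q := by
  rw [abs_div, abs_of_pos hl, Real.div_rpow (abs_nonneg _) hl.le]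
  have h1 : l ^ q ≤ K ^ P :=
    (Real.rpow_le_rpow hl.le hlK hq).trans (Real.rpow_le_rpow_of_exponent_le hK hqP)
  have h2 : 0 < l ^ q := Real.rpow_pos_of_pos hl q
  calc |a| ^ q = l ^ q * (|a| ^ q / l ^ q) := by field_simp
    _ ≤ _ := by gcongr

section Modular

variable {N : ℕ} {Ω : Set (EuclideanSpace ℝ (Fin N))} {u : EuclideanSpace ℝ (Fin N) → ℝ}

lemma modLq_div_le {q : EuclideanSpace ℝ (Fin N) → ℝ} (hq : ∀ x, 1 ≤ q x) {l : ℝ} (hl : 1 ≤ l) :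
    modLq Ω q (fun x => u x / l) ≤ ENNReal.ofReal l⁻¹ * modLq Ω q u := by
  unfold modLq
  rw [← lintegral_const_mul' _ _ ENNReal.ofReal_ne_top]
  refine lintegral_mono fun x => ?_
  rw [← ENNReal.ofReal_mul (by positivity)]
  exact ENNReal.ofReal_le_ofReal (abs_div_rpow_le hl (hq x))

lemma modLq_le_mul_modLq_div {q : EuclideanSpace ℝ (Fin N) → ℝ} (hq : ∀ x, 0 ≤ q x) {P : ℝ}
    (hqP : ∀ x, q x ≤ P) {l K : ℝ} (hl : 0 < l) (hlK : l ≤ K) (hK : 1 ≤ K) :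
    modLq Ω q u ≤ ENNReal.ofReal (K ^ P) * modLq Ω q (fun x => u x / l) := by
  unfold modLq
  rw [← lintegral_const_mul' _ _ ENNReal.ofReal_ne_top]
  refine lintegral_mono fun x => ?_
  rw [← ENNReal.ofReal_mul (by positivity)]
  exact ENNReal.ofReal_le_ofReal (abs_rpow_le_mul_abs_div_rpow hl hlK hK (hq x) (hqP x))

lemma gagMod_div_le {s : ℝ} {p : EuclideanSpace ℝ (Fin N) → EuclideanSpace ℝ (Fin N) → ℝ}
    (hp : ∀ x y, 1 ≤ p x y) {l : ℝ} (hl : 1 ≤ l) :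
    gagMod Ω s p (fun x => u x / l) ≤ ENNReal.ofReal l⁻¹ * gagMod Ω s p u := by
  unfold gagMod
  rw [← lintegral_const_mul' _ _ ENNReal.ofReal_ne_top]
  refine lintegral_mono fun x => ?_
  rw [← lintegral_const_mul' _ _ ENNReal.ofReal_ne_top]
  refine lintegral_mono fun y => ?_
  rw [← ENNReal.ofReal_mul (by positivity), ← sub_div, ← mul_div_assoc]
  have := abs_div_rpow_le (a := u x - u y) hl (hp x y)
  exact ENNReal.ofReal_le_ofReal (by gcongr)

lemma gagMod_le_mul_gagMod_div {s : ℝ}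
    {p : EuclideanSpace ℝ (Fin N) → EuclideanSpace ℝ (Fin N) → ℝ}
    (hp : ∀ x y, 0 ≤ p x y) {P : ℝ} (hpP : ∀ x y, p x y ≤ P) {l K : ℝ} (hl : 0 < l)
    (hlK : l ≤ K) (hK : 1 ≤ K) :
    gagMod Ω s p u ≤ ENNReal.ofReal (K ^ P) * gagMod Ω s p (fun x => u x / l) := by
  unfold gagMod
  rw [← lintegral_const_mul' _ _ ENNReal.ofReal_ne_top]
  refine lintegral_mono fun x => ?_
  rw [← lintegral_const_mul' _ _ ENNReal.ofReal_ne_top]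
  refine lintegral_mono fun y => ?_
  rw [← ENNReal.ofReal_mul (by positivity), ← sub_div, ← mul_div_assoc]
  have := abs_rpow_le_mul_abs_div_rpow (a := u x - u y) hl hlK hK (hp x y) (hpP x y)
  exact ENNReal.ofReal_le_ofReal (by gcongr)

lemma exists_ofReal_inv_mul_lt_one {A : ℝ≥0∞} (hA : A < ⊤) :
    ∃ l : ℝ, 1 ≤ l ∧ ENNReal.ofReal l⁻¹ * A < 1 := by
  refine ⟨A.toReal + 1, by simp, ?_⟩
  rw [← ENNReal.ofReal_toReal hA.ne, ← ENNReal.ofReal_mul (by positivity), ENNReal.ofReal_lt_one,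
    ENNReal.toReal_ofReal ENNReal.toReal_nonneg, inv_mul_lt_iff₀ (by positivity)]
  linarith

lemma luxNorm_nonneg {q : EuclideanSpace ℝ (Fin N) → ℝ} : 0 ≤ luxNorm Ω q u :=
  Real.sInf_nonneg fun _ h => h.1.le

lemma gagSeminorm_nonneg {s : ℝ} {p : EuclideanSpace ℝ (Fin N) → EuclideanSpace ℝ (Fin N) → ℝ} :
    0 ≤ gagSeminorm Ω s p u :=
  Real.sInf_nonneg fun _ h => h.1.le

/-- A function whose Luxemburg norm is controlled has controlled modular. -/
lemma modLq_le_of_luxNorm_lt {q : EuclideanSpace ℝ (Fin N) → ℝ} (hq : ∀ x, 1 ≤ q x) {P : ℝ}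
    (hqP : ∀ x, q x ≤ P) {K : ℝ} (hK : 1 ≤ K) (hu : modLq Ω q u < ⊤) (hn : luxNorm Ω q u < K) :
    modLq Ω q u ≤ ENNReal.ofReal (K ^ P) := by
  obtain ⟨l₀, h1, h2⟩ := exists_ofReal_inv_mul_lt_one hu
  have hne : {l : ℝ | 0 < l ∧ modLq Ω q (fun x => u x / l) ≤ 1}.Nonempty :=
    ⟨l₀, zero_lt_one.trans_le h1, (modLq_div_le hq h1).trans h2.le⟩
  obtain ⟨l, ⟨hl0, hl⟩, hlK⟩ := exists_lt_of_csInf_lt hne hn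
  refine (modLq_le_mul_modLq_div (fun x => zero_le_one.trans (hq x)) hqP hl0 hlK.le hK).trans ?_
  exact (mul_le_mul_right hl _).trans (mul_one _).le

/-- A function whose Gagliardo seminorm is controlled has controlled Gagliardo modular. -/
lemma gagMod_le_of_gagSeminorm_lt {s : ℝ}
    {p : EuclideanSpace ℝ (Fin N) → EuclideanSpace ℝ (Fin N) → ℝ}
    (hp : ∀ x y, 1 ≤ p x y) {P : ℝ} (hpP : ∀ x y, p x y ≤ P) {K : ℝ} (hK : 1 ≤ K)
    (hu : gagMod Ω s p u < ⊤) (hn : gagSeminorm Ω s p u < K) :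
    gagMod Ω s p u ≤ ENNReal.ofReal (K ^ P) := by
  obtain ⟨l₀, h1, h2⟩ := exists_ofReal_inv_mul_lt_one hu
  have hne : {l : ℝ | 0 < l ∧ gagMod Ω s p (fun x => u x / l) < 1}.Nonempty :=
    ⟨l₀, zero_lt_one.trans_le h1, (gagMod_div_le hp h1).trans_lt h2⟩
  obtain ⟨l, ⟨hl0, hl⟩, hlK⟩ := exists_lt_of_csInf_lt hne hn
  refine (gagMod_le_mul_gagMod_div (fun x y => zero_le_one.trans (hp x y)) hpP hl0 hlK.le
    hK).trans ?_
  exact (mul_le_mul_right hl.le _).trans (mul_one _).le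

lemma lintegral_abs_le_volume_add_modLq {q : EuclideanSpace ℝ (Fin N) → ℝ} (hq : ∀ x, 1 ≤ q x)
    (T : Set (EuclideanSpace ℝ (Fin N))) :
    ∫⁻ x in T, ENNReal.ofReal |u x| ≤ volume T + modLq Set.univ q u := by
  have h : ∀ x, ENNReal.ofReal |u x| ≤ 1 + ENNReal.ofReal (|u x| ^ q x) := fun x => by
    rw [← ENNReal.ofReal_one, ← ENNReal.ofReal_add zero_le_one (by positivity)]
    simpa using ENNReal.ofReal_le_ofReal
      (rpow_le_one_add_rpow (abs_nonneg (u x)) zero_le_one (hq x))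
  refine (lintegral_mono h).trans ?_
  rw [lintegral_add_left measurable_const, setLIntegral_const, one_mul]
  exact add_le_add le_rfl (lintegral_mono_set (Set.subset_univ T))

end Modular

lemma rpow_scaling_bound {s t n h X C : ℝ} (ht : 1 ≤ t) (hh : 0 < h) (hh1 : h ≤ 1)
    (hn : 0 ≤ n) (hX : X ≤ C * h ^ (-(2 * n))) :
    h ^ (-(n / t - s)) + (h ^ (-(n / t - s))) ^ (1 - t) * (2 * h) ^ (s * t) +
        (h ^ (-(n / t - s))) ^ (1 - t) * (2 * h) ^ (s * t + n) * X ≤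
      (1 + 2 ^ (s * t) + 2 ^ (s * t + n) * C) * h ^ (-(n / t - s)) := by
  have ht0 : t ≠ 0 := by positivity
  set δ := h ^ (-(n / t - s)) with hδ
  have hδ0 : 0 < δ := Real.rpow_pos_of_pos hh _
  have e1 : δ ^ (1 - t) * h ^ (s * t) = δ * h ^ n := by
    rw [hδ, ← Real.rpow_mul hh.le, ← Real.rpow_add hh, ← Real.rpow_add hh]
    congr 1; field_simp; ring
  have e2 : δ ^ (1 - t) * h ^ (s * t + n) * h ^ (-(2 * n)) = δ := by
    rw [Real.rpow_add hh, ← mul_assoc, e1, mul_assoc, mul_assoc, ← Real.rpow_add hh,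
      ← Real.rpow_add hh, show n + (n + -(2 * n)) = 0 by ring, Real.rpow_zero, mul_one]
  have h1 : h ^ n ≤ 1 := Real.rpow_le_one hh.le hh1 hn
  rw [Real.mul_rpow zero_le_two hh.le, Real.mul_rpow zero_le_two hh.le]
  have h2 : δ ^ (1 - t) * (2 ^ (s * t) * h ^ (s * t)) ≤ 2 ^ (s * t) * δ := by
    calc _ = 2 ^ (s * t) * (δ * h ^ n) := by rw [← e1]; ring
      _ ≤ 2 ^ (s * t) * (δ * 1) := by gcongr
      _ = _ := by ring
  have h3 : δ ^ (1 - t) * (2 ^ (s * t + n) * h ^ (s * t + n)) * X ≤ 2 ^ (s * t + n) * C * δ := by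
    calc _ ≤ δ ^ (1 - t) * (2 ^ (s * t + n) * h ^ (s * t + n)) * (C * h ^ (-(2 * n))) := by gcongr
      _ = 2 ^ (s * t + n) * C * (δ ^ (1 - t) * h ^ (s * t + n) * h ^ (-(2 * n))) := by ring
      _ = _ := by rw [e2]
  linarith

lemma le_add_mul_of_ofReal_mul_le {D A B X : ℝ} {m G : ℝ≥0∞} (hm0 : m ≠ 0) (hm : m ≠ ⊤)
    (hA : 0 ≤ A) (hB : 0 ≤ B) (hX : 0 ≤ X) (hG : G ≤ ENNReal.ofReal X * m)
    (h : ENNReal.ofReal D * m ≤ ENNReal.ofReal A * m + ENNReal.ofReal B * G) :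
    D ≤ A + B * X := by
  have h1 : ENNReal.ofReal D * m ≤ ENNReal.ofReal (A + B * X) * m := by
    refine h.trans ?_
    rw [ENNReal.ofReal_add hA (by positivity), ENNReal.ofReal_mul hB, add_mul, mul_assoc]
    gcongr
  exact (ENNReal.ofReal_le_ofReal_iff (by positivity)).1
    ((ENNReal.mul_le_mul_iff_left hm0 hm).1 h1)

/-- The volume of the unit ball. -/
def unitBallVol (N : ℕ) : ℝ := (volume (ball (0 : EuclideanSpace ℝ (Fin N)) 1)).toReal

lemma unitBallVol_pos (N : ℕ) : 0 < unitBallVol N :=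
  ENNReal.toReal_pos (measure_ball_pos _ _ one_pos).ne' measure_ball_lt_top.ne

lemma volume_ball_eq {N : ℕ} (x : EuclideanSpace ℝ (Fin N)) {h : ℝ} (hh : 0 < h) :
    volume (ball x h) = ENNReal.ofReal (h ^ N * unitBallVol N) := by
  rw [Measure.addHaar_ball_of_pos _ _ hh, ENNReal.ofReal_mul (by positivity), unitBallVol,
    ENNReal.ofReal_toReal measure_ball_lt_top.ne, finrank_euclideanSpace_fin]

section Local

variable {N : ℕ} {s t h₀ : ℝ} {x₀ : EuclideanSpace ℝ (Fin N)}
  {p : EuclideanSpace ℝ (Fin N) → EuclideanSpace ℝ (Fin N) → ℝ}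
  {u : EuclideanSpace ℝ (Fin N) → ℝ}

/-- Means over concentric balls of radii `h` and `h / 2` are close. -/
lemma abs_average_half_sub_average_le (hs : 0 ≤ s) (ht : 1 ≤ t) (h₀1 : h₀ ≤ 1)
    (htp : ∀ x ∈ ball x₀ (2 * h₀), ∀ y ∈ ball x₀ (2 * h₀), t ≤ p x y)
    (hu : IntegrableOn u (ball x₀ (2 * h₀))) {K : ℝ} (hK : 0 ≤ K)
    (hG : gagMod Set.univ s p u ≤ ENNReal.ofReal K)
    {x : EuclideanSpace ℝ (Fin N)} (hx : x ∈ ball x₀ h₀) {h : ℝ} (hh : 0 < h) (hhh : h ≤ h₀) :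
    |(⨍ y in ball x (h / 2), u y) - ⨍ y in ball x h, u y| ≤
      (1 + 2 ^ (s * t) + 2 ^ (s * t + N) * (K * 2 ^ N / unitBallVol N ^ 2)) *
        h ^ (-(N / t - s)) := by
  have hω := unitBallVol_pos N
  have hT : ball x h ⊆ ball x₀ (2 * h₀) := ball_subset_ball' (by rw [mem_ball] at hx; linarith)
  have hST : ball x (h / 2) ⊆ ball x h := ball_subset_ball (by linarith)
  have hS := hST.trans hT
  have hδ : 0 < h ^ (-(N / t - s)) := Real.rpow_pos_of_pos hh _
  have hS0 : volume (ball x (h / 2)) ≠ 0 := (measure_ball_pos _ _ (by positivity)).ne'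
  have hT0 : volume (ball x h) ≠ 0 := (measure_ball_pos _ _ (by positivity)).ne'
  have hSt : volume (ball x (h / 2)) ≠ ⊤ := measure_ball_lt_top.ne
  have hTt : volume (ball x h) ≠ ⊤ := measure_ball_lt_top.ne
  refine le_trans ?_ (rpow_scaling_bound (s := s) (t := t) (n := N) (h := h)
    (X := K * 2 ^ N / unitBallVol N ^ 2 * h ^ (-(2 * N : ℝ))) ht hh (hhh.trans h₀1)
    N.cast_nonneg le_rfl)
  refine le_add_mul_of_ofReal_mul_le (m := volume (ball x h) * volume (ball x (h / 2)))
    (G := gagMod Set.univ s p u) (mul_ne_zero hT0 hS0) (ENNReal.mul_ne_top hTt hSt)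
    (by positivity) (by positivity) (by positivity) ?_ ?_
  · refine hG.trans (le_of_eq ?_)
    rw [volume_ball_eq x hh, volume_ball_eq x (half_pos hh), ← ENNReal.ofReal_mul (by positivity),
      ← ENNReal.ofReal_mul (by positivity)]
    congr 1
    rw [Real.rpow_neg hh.le, mul_comm (2 : ℝ) N, Real.rpow_mul hh.le, Real.rpow_natCast,
      Real.rpow_two, div_pow]
    field_simp
  · set b := ⨍ y in ball x h, u y
    calc ENNReal.ofReal |(⨍ y in ball x (h / 2), u y) - b| *
          (volume (ball x h) * volume (ball x (h / 2)))
        = ENNReal.ofReal |b - ⨍ y in ball x (h / 2), u y| * volume (ball x (h / 2)) *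
            volume (ball x h) := by rw [abs_sub_comm]; ring
      _ ≤ (∫⁻ z in ball x (h / 2), ENNReal.ofReal |b - u z|) * volume (ball x h) := by
          gcongr; exact ofReal_abs_sub_average_mul_le hS0 hSt (hu.mono_set hS) b
      _ = ∫⁻ z in ball x (h / 2), ENNReal.ofReal |u z - b| * volume (ball x h) := by
          rw [lintegral_mul_const' _ _ hTt]; simp_rw [abs_sub_comm b]
      _ ≤ ∫⁻ z in ball x (h / 2), (ENNReal.ofReal (h ^ (-(N / t - s)) +
            (h ^ (-(N / t - s))) ^ (1 - t) * (2 * h) ^ (s * t)) * volume (ball x h) +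
            ENNReal.ofReal ((h ^ (-(N / t - s))) ^ (1 - t) * (2 * h) ^ (s * t + N)) *
              ∫⁻ y in ball x h, ENNReal.ofReal (gagIntegrand s p u z y)) := by
          refine setLIntegral_mono' measurableSet_ball fun z hz => ?_
          refine (ofReal_abs_sub_average_mul_le hT0 hTt (hu.mono_set hT) (u z)).trans ?_
          refine lintegral_abs_sub_le_gag u measurableSet_ball hs ht hδ (by positivity)
            (fun y hy => htp z (hS hz) y (hT hy)) fun y hy => ?_
          have := dist_triangle_right z y x
          have h1 := mem_ball.1 (hST hz)
          have h2 := mem_ball.1 hy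
          linarith
      _ ≤ _ := by
          rw [lintegral_add_left measurable_const, setLIntegral_const,
            lintegral_const_mul' _ _ ENNReal.ofReal_ne_top, mul_assoc]
          gcongr
          refine (lintegral_mono_set (Set.subset_univ _)).trans (lintegral_mono fun z => ?_)
          exact lintegral_mono_set (Set.subset_univ _)

/-- The distance of `u x` to its mean over a ball whose radius is adapted to the size of the
inner Gagliardo integral. -/
lemma abs_sub_average_le (hs : 0 ≤ s) (ht : 1 ≤ t) (h₀1 : h₀ ≤ 1)
    (htp : ∀ x ∈ ball x₀ (2 * h₀), ∀ y ∈ ball x₀ (2 * h₀), t ≤ p x y)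
    (hu : IntegrableOn u (ball x₀ (2 * h₀))) {x : EuclideanSpace ℝ (Fin N)} (hx : x ∈ ball x₀ h₀)
    {h C : ℝ} (hh : 0 < h) (hhh : h ≤ h₀) (hC : 0 ≤ C)
    (hG : ∫⁻ y, ENNReal.ofReal (gagIntegrand s p u x y) ≤ ENNReal.ofReal (C * h ^ (-(N : ℝ)))) :
    |u x - ⨍ y in ball x h, u y| ≤
      (1 + 2 ^ (s * t) + 2 ^ (s * t + N) * (C / unitBallVol N)) * h ^ (-(N / t - s)) := by
  have hω := unitBallVol_pos N
  have hT : ball x h ⊆ ball x₀ (2 * h₀) := ball_subset_ball' (by rw [mem_ball] at hx; linarith)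
  have hx' : x ∈ ball x₀ (2 * h₀) := hT (mem_ball_self hh)
  have hT0 : volume (ball x h) ≠ 0 := (measure_ball_pos _ _ (by positivity)).ne'
  have hTt : volume (ball x h) ≠ ⊤ := measure_ball_lt_top.ne
  refine le_trans ?_ (rpow_scaling_bound (s := s) (t := t) (n := N) (h := h)
    (X := C / unitBallVol N * h ^ (-(2 * N : ℝ))) ht hh (hhh.trans h₀1)
    N.cast_nonneg le_rfl)
  refine le_add_mul_of_ofReal_mul_le (m := volume (ball x h))
    (G := ∫⁻ y in ball x h, ENNReal.ofReal (gagIntegrand s p u x y)) hT0 hTt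
    (by positivity) (by positivity) (by positivity) ?_ ?_
  · refine (lintegral_mono_set (Set.subset_univ _)).trans ?_
    rw [setLIntegral_univ]
    refine hG.trans (le_of_eq ?_)
    rw [volume_ball_eq x hh, ← ENNReal.ofReal_mul (by positivity)]
    congr 1
    rw [Real.rpow_neg hh.le, Real.rpow_neg hh.le, mul_comm (2 : ℝ) N, Real.rpow_mul hh.le,
      Real.rpow_natCast, Real.rpow_two]
    field_simp
  · refine (ofReal_abs_sub_average_mul_le hT0 hTt (hu.mono_set hT) (u x)).trans ?_
    refine lintegral_abs_sub_le_gag u measurableSet_ball hs ht (Real.rpow_pos_of_pos hh _)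
      (by positivity) (fun y hy => htp x hx' y (hT hy)) fun y hy => ?_
    rw [dist_comm]
    linarith [mem_ball.1 hy]

lemma abs_average_le {T : Set (EuclideanSpace ℝ (Fin N))} {L : ℝ} (hL : 0 ≤ L)
    (hu : ∫⁻ y in T, ENNReal.ofReal |u y| ≤ ENNReal.ofReal L) :
    |⨍ y in T, u y| ≤ L / (volume T).toReal := by
  rw [setAverage_eq, smul_eq_mul, abs_mul, abs_inv, div_eq_inv_mul, Measure.real,
    abs_of_nonneg ENNReal.toReal_nonneg]
  gcongr
  have := norm_integral_le_lintegral_norm (μ := volume.restrict T) u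
  simp only [Real.norm_eq_abs] at this
  exact this.trans (ENNReal.toReal_le_of_le_ofReal hL hu)

/-- Growth of the means over balls of radii `h₀ / 2 ^ j`. -/
lemma abs_average_dyadic_le (hs : 0 ≤ s) (ht : 1 ≤ t) (hst : s * t < N) (h₀0 : 0 < h₀)
    (h₀1 : h₀ ≤ 1)
    (htp : ∀ x ∈ ball x₀ (2 * h₀), ∀ y ∈ ball x₀ (2 * h₀), t ≤ p x y)
    (hu : IntegrableOn u (ball x₀ (2 * h₀))) {K L : ℝ} (hK : 0 ≤ K) (hL : 0 ≤ L)
    (hG : gagMod Set.univ s p u ≤ ENNReal.ofReal K)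
    (hL1 : ∫⁻ y in ball x₀ (2 * h₀), ENNReal.ofReal |u y| ≤ ENNReal.ofReal L)
    {x : EuclideanSpace ℝ (Fin N)} (hx : x ∈ ball x₀ h₀) (j : ℕ) :
    |⨍ y in ball x (h₀ / 2 ^ j), u y| ≤
      (L / (h₀ ^ N * unitBallVol N) +
        (1 + 2 ^ (s * t) + 2 ^ (s * t + N) * (K * 2 ^ N / unitBallVol N ^ 2)) /
          (2 ^ (N / t - s) - 1)) * (h₀ / 2 ^ j) ^ (-(N / t - s)) := by
  have hω := unitBallVol_pos N
  have hα : 0 < N / t - s := by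
    rw [sub_pos, lt_div_iff₀ (by positivity)]; exact hst
  have h2 : (1 : ℝ) < 2 ^ (N / t - s) := Real.one_lt_rpow one_lt_two hα
  have h2' : (0 : ℝ) < 2 ^ (N / t - s) - 1 := by linarith
  set C₁ := 1 + 2 ^ (s * t) + 2 ^ (s * t + N) * (K * 2 ^ N / unitBallVol N ^ 2) with hC₁
  have hC₁0 : 0 ≤ C₁ := by positivity
  have hB0 : 0 ≤ L / (h₀ ^ N * unitBallVol N) := by positivity
  induction j with
  | zero =>
    have hT : ball x h₀ ⊆ ball x₀ (2 * h₀) :=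
      ball_subset_ball' (by rw [mem_ball] at hx; linarith)
    have h1 := abs_average_le hL ((lintegral_mono_set hT).trans hL1)
    rw [volume_ball_eq x h₀0, ENNReal.toReal_ofReal (by positivity)] at h1
    rw [pow_zero, div_one]
    have h3 : 1 ≤ h₀ ^ (-(N / t - s)) :=
      Real.one_le_rpow_of_pos_of_le_one_of_nonpos h₀0 h₀1 (by linarith)
    calc _ ≤ L / (h₀ ^ N * unitBallVol N) * 1 := by rw [mul_one]; exact h1
      _ ≤ _ := by
        gcongr
        have : 0 ≤ C₁ / (2 ^ (N / t - s) - 1) := by positivity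
        linarith
  | succ j ih =>
    have hh : 0 < h₀ / 2 ^ j := by positivity
    have h1 := abs_average_half_sub_average_le hs ht h₀1 htp hu hK hG hx hh
      (div_le_self h₀0.le (one_le_pow₀ one_le_two))
    rw [← hC₁] at h1
    rw [show h₀ / 2 ^ (j + 1) = h₀ / 2 ^ j / 2 by rw [pow_succ, div_div]]
    have e : (h₀ / 2 ^ j / 2) ^ (-(N / t - s)) =
        2 ^ (N / t - s) * (h₀ / 2 ^ j) ^ (-(N / t - s)) := by
      rw [Real.div_rpow hh.le zero_le_two, Real.rpow_neg zero_le_two, div_inv_eq_mul, mul_comm]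
    rw [e]
    set δ := (h₀ / 2 ^ j) ^ (-(N / t - s)) with hδ
    have hδ0 : 0 < δ := Real.rpow_pos_of_pos hh _
    have h3 : L / (h₀ ^ N * unitBallVol N) + C₁ / (2 ^ (N / t - s) - 1) + C₁ ≤
        (L / (h₀ ^ N * unitBallVol N) + C₁ / (2 ^ (N / t - s) - 1)) * 2 ^ (N / t - s) := by
      have e1 : C₁ / (2 ^ (N / t - s) - 1) * 2 ^ (N / t - s) =
          C₁ / (2 ^ (N / t - s) - 1) + C₁ := by
        rw [div_mul_eq_mul_div, div_add' _ _ _ h2'.ne']; ring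
      rw [add_mul, e1]
      nlinarith
    have h4 := abs_sub_abs_le_abs_sub (⨍ y in ball x (h₀ / 2 ^ j / 2), u y)
      (⨍ y in ball x (h₀ / 2 ^ j), u y)
    have h5 := mul_le_mul_of_nonneg_right h3 hδ0.le
    linarith

/-- Local fractional Sobolev inequality: bounds on the Gagliardo modular and on the local `L¹`
norm give a local bound with the critical exponent. -/
lemma exists_lintegral_rpow_le (hs : 0 ≤ s) (ht : 1 ≤ t) (hst : s * t < N) (h₀0 : 0 < h₀)
    (h₀1 : h₀ ≤ 1)
    (htp : ∀ x ∈ ball x₀ (2 * h₀), ∀ y ∈ ball x₀ (2 * h₀), t ≤ p x y)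
    {K L : ℝ} (hK : 0 ≤ K) (hL : 0 ≤ L) :
    ∃ C : ℝ≥0∞, C ≠ ⊤ ∧ ∀ u : EuclideanSpace ℝ (Fin N) → ℝ, Measurable u →
      gagMod Set.univ s p u ≤ ENNReal.ofReal K →
      ∫⁻ y in ball x₀ (2 * h₀), ENNReal.ofReal |u y| ≤ ENNReal.ofReal L →
      ∫⁻ y in ball x₀ h₀, ENNReal.ofReal (|u y| ^ (N * t / (N - s * t))) ≤ C := by
  have hω := unitBallVol_pos N
  have ht0 : 0 < t := by positivity
  have hα : 0 < N / t - s := by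
    rw [sub_pos, lt_div_iff₀ (by positivity)]; exact hst
  have h2' : (0 : ℝ) < 2 ^ (N / t - s) - 1 := by
    linarith [Real.one_lt_rpow one_lt_two hα]
  have hst' : 0 < N - s * t := by linarith
  have hN : 0 < (N : ℝ) := lt_of_le_of_lt (by positivity) hst
  set q := N * t / (N - s * t) with hq
  have hq0 : 0 ≤ q := by positivity
  have hαq : (N / t - s) * q = N := by
    rw [hq, div_sub' ht0.ne', mul_comm t s]; field_simp
  obtain ⟨C₂, hC₂, hC₂'⟩ : ∃ C₂ : ℝ, 0 ≤ C₂ ∧ C₂ = (L / (h₀ ^ N * unitBallVol N) +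
        (1 + 2 ^ (s * t) + 2 ^ (s * t + N) * (K * 2 ^ N / unitBallVol N ^ 2)) /
          (2 ^ (N / t - s) - 1)) := ⟨_, by positivity, rfl⟩
  obtain ⟨C₃, hC₃, hC₃'⟩ : ∃ C₃ : ℝ, 0 ≤ C₃ ∧
      C₃ = (1 + 2 ^ (s * t) + 2 ^ (s * t + N) * (2 ^ N / unitBallVol N)) :=
    ⟨_, by positivity, rfl⟩
  set A := (C₂ + C₃ + 1) ^ q * (h₀ ^ N)⁻¹ with hA
  have hA0 : 0 < A := by positivity
  refine ⟨ENNReal.ofReal A * (volume (ball x₀ h₀) + ENNReal.ofReal K),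
    ENNReal.mul_ne_top ENNReal.ofReal_ne_top
      (ENNReal.add_ne_top.2 ⟨measure_ball_lt_top.ne, ENNReal.ofReal_ne_top⟩), ?_⟩
  intro u hum hG hL1
  have hu : IntegrableOn u (ball x₀ (2 * h₀)) := by
    refine ⟨hum.aestronglyMeasurable, ?_⟩
    rw [hasFiniteIntegral_iff_norm]
    exact hL1.trans_lt ENNReal.ofReal_lt_top
  have key : ∀ x ∈ ball x₀ h₀, ENNReal.ofReal (|u x| ^ q) ≤
      ENNReal.ofReal A * (1 + ∫⁻ y, ENNReal.ofReal (gagIntegrand s p u x y)) := by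
    intro x hx
    rcases eq_or_ne (∫⁻ y, ENNReal.ofReal (gagIntegrand s p u x y)) ⊤ with htop | htop
    · rw [htop, add_top, ENNReal.mul_top (by simpa using hA0)]
      exact le_top
    set G := (∫⁻ y, ENNReal.ofReal (gagIntegrand s p u x y)).toReal with hGdef
    have hG0 : 0 ≤ G := ENNReal.toReal_nonneg
    rw [← ENNReal.ofReal_toReal htop, ← ENNReal.ofReal_one, ← ENNReal.ofReal_add zero_le_one hG0,
      ← ENNReal.ofReal_mul hA0.le]
    refine ENNReal.ofReal_le_ofReal ?_
    have hN' : N ≠ 0 := by exact_mod_cast hN.ne'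
    obtain ⟨j, hj1, hj2⟩ := exists_nat_pow_near (x := 1 + G) (y := (2 : ℝ) ^ N) (by linarith)
      (one_lt_pow₀ one_lt_two hN')
    have hh : 0 < h₀ / 2 ^ j := by positivity
    have hhh : h₀ / 2 ^ j ≤ h₀ := div_le_self h₀0.le (one_le_pow₀ one_le_two)
    have e1 : (h₀ / 2 ^ j) ^ (-(N : ℝ)) = (h₀ ^ N)⁻¹ * (2 ^ N) ^ j := by
      rw [Real.rpow_neg hh.le, Real.rpow_natCast, div_pow, inv_div, div_eq_inv_mul, ← pow_mul,
        ← pow_mul, mul_comm j]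
    have h1 := abs_average_dyadic_le hs ht hst h₀0 h₀1 htp hu hK hL hG hL1 hx j
    have h3 := abs_sub_average_le hs ht h₀1 htp hu hx hh hhh (C := 2 ^ N) (by positivity) (by
      rw [← ENNReal.ofReal_toReal htop, ← hGdef]
      refine ENNReal.ofReal_le_ofReal ?_
      rw [e1]
      have h5 : 1 ≤ (h₀ ^ N)⁻¹ := (one_le_inv₀ (by positivity)).2 (pow_le_one₀ h₀0.le h₀1)
      calc G ≤ (2 ^ N) ^ (j + 1) := by linarith
        _ = 2 ^ N * (1 * (2 ^ N) ^ j) := by rw [pow_succ]; ring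
        _ ≤ _ := by gcongr)
    rw [← hC₂'] at h1
    rw [← hC₃'] at h3
    have hδ : 0 < (h₀ / 2 ^ j) ^ (-(N / t - s)) := Real.rpow_pos_of_pos hh _
    have h4 : |u x| ≤ (C₂ + C₃ + 1) * (h₀ / 2 ^ j) ^ (-(N / t - s)) := by
      have := abs_sub_abs_le_abs_sub (u x) (⨍ y in ball x (h₀ / 2 ^ j), u y)
      linarith
    calc |u x| ^ q ≤ ((C₂ + C₃ + 1) * (h₀ / 2 ^ j) ^ (-(N / t - s))) ^ q := by gcongr
      _ = (C₂ + C₃ + 1) ^ q * (h₀ / 2 ^ j) ^ (-(N : ℝ)) := by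
        rw [Real.mul_rpow (by positivity) hδ.le, ← Real.rpow_mul hh.le, neg_mul, hαq]
      _ = A * (2 ^ N) ^ j := by rw [e1, hA]; ring
      _ ≤ A * (1 + G) := by gcongr
  refine (setLIntegral_mono' measurableSet_ball key).trans ?_
  rw [lintegral_const_mul' _ _ ENNReal.ofReal_ne_top, lintegral_add_left measurable_const,
    setLIntegral_const, one_mul]
  gcongr
  refine le_trans ?_ hG
  unfold gagMod
  simp only [setLIntegral_univ]
  exact lintegral_mono_set (Set.subset_univ _) |>.trans (by rw [setLIntegral_univ]; rfl)

end Local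

section Compactness

variable {N : ℕ} {s : ℝ} {p : EuclideanSpace ℝ (Fin N) → EuclideanSpace ℝ (Fin N) → ℝ}

/-- Approximation in `L¹` by means over balls of radius `h` with nearby centres, uniformly on sets
of bounded Gagliardo modular. -/
lemma lintegral_abs_sub_average_le {u : EuclideanSpace ℝ (Fin N) → ℝ} (hs : 0 ≤ s)
    (hp : ∀ x y, 1 ≤ p x y) (hu : ∀ x h, IntegrableOn u (ball x h))
    {B : Set (EuclideanSpace ℝ (Fin N))} (hB : MeasurableSet B)
    {h : ℝ} (hh : 0 < h) {τ : EuclideanSpace ℝ (Fin N) → EuclideanSpace ℝ (Fin N)}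
    (hτ : ∀ x ∈ B, dist x (τ x) ≤ h) :
    ∫⁻ x in B, ENNReal.ofReal |u x - ⨍ y in ball (τ x) h, u y| ≤
      ENNReal.ofReal (h ^ s) * (ENNReal.ofReal (1 + 2 ^ s) * volume B +
        ENNReal.ofReal (2 ^ (s + N) / unitBallVol N) * gagMod Set.univ s p u) := by
  have hω := unitBallVol_pos N
  have key : ∀ x ∈ B, ENNReal.ofReal |u x - ⨍ y in ball (τ x) h, u y| ≤
      ENNReal.ofReal (h ^ s) * (ENNReal.ofReal (1 + 2 ^ s) +
        ENNReal.ofReal (2 ^ (s + N) / unitBallVol N) *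
          ∫⁻ y, ENNReal.ofReal (gagIntegrand s p u x y)) := by
    intro x hx
    have hT0 : volume (ball (τ x) h) ≠ 0 := (measure_ball_pos _ _ hh).ne'
    have hTt : volume (ball (τ x) h) ≠ ⊤ := measure_ball_lt_top.ne
    rw [← ENNReal.mul_le_mul_iff_left hT0 hTt]
    refine (ofReal_abs_sub_average_mul_le hT0 hTt (hu _ _) (u x)).trans ?_
    refine (lintegral_abs_sub_le_gag u measurableSet_ball hs le_rfl
      (Real.rpow_pos_of_pos hh s) (h := 2 * h) (by positivity) (fun y _ => hp x y)
      fun y hy => ?_).trans (?_ : _ ≤ ENNReal.ofReal (h ^ s) * (ENNReal.ofReal (1 + 2 ^ s) +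
        ENNReal.ofReal (2 ^ (s + N) / unitBallVol N) *
          ∫⁻ y, ENNReal.ofReal (gagIntegrand s p u x y)) * volume (ball (τ x) h))
    · have := dist_triangle_right x y (τ x)
      linarith [mem_ball.1 hy, hτ x hx]
    · rw [mul_add, add_mul]
      refine add_le_add (le_of_eq ?_) ?_
      · rw [← ENNReal.ofReal_mul (by positivity)]
        congr 2
        rw [sub_self, Real.rpow_zero, mul_one, Real.mul_rpow zero_le_two hh.le]
        ring
      · refine (mul_le_mul_right (lintegral_mono_set (Set.subset_univ _)) _).trans (le_of_eq ?_)
        rw [setLIntegral_univ, volume_ball_eq _ hh, ← mul_assoc, mul_right_comm,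
          ← ENNReal.ofReal_mul (by positivity), ← ENNReal.ofReal_mul (by positivity)]
        congr 2
        rw [sub_self, Real.rpow_zero, one_mul, mul_one, Real.mul_rpow zero_le_two hh.le,
          Real.rpow_add hh, Real.rpow_natCast]
        field_simp
  refine (setLIntegral_mono' hB key).trans ?_
  rw [lintegral_const_mul' _ _ ENNReal.ofReal_ne_top, lintegral_add_left measurable_const,
    setLIntegral_const, lintegral_const_mul' _ _ ENNReal.ofReal_ne_top]
  gcongr
  unfold gagMod
  refine (lintegral_mono_set (Set.subset_univ _)).trans (le_of_eq ?_)
  simp only [setLIntegral_univ]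
  rfl

lemma exists_nearestPtInd_dist_lt (c : EuclideanSpace ℝ (Fin N)) (ρ : ℝ) {h : ℝ} (hh : 0 < h) :
    ∃ n : ℕ, ∀ x ∈ ball c ρ, dist x (TopologicalSpace.denseSeq (EuclideanSpace ℝ (Fin N))
      (SimpleFunc.nearestPtInd (TopologicalSpace.denseSeq (EuclideanSpace ℝ (Fin N))) n x)) ≤ h := by
  set e := TopologicalSpace.denseSeq (EuclideanSpace ℝ (Fin N)) with he
  obtain ⟨t, ht⟩ := (isCompact_closedBall c ρ).elim_finite_subcover (fun i : ℕ => ball (e i) h)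
    (fun _ => isOpen_ball) fun x _ => by
      obtain ⟨i, hi⟩ := (TopologicalSpace.denseRange_denseSeq
        (EuclideanSpace ℝ (Fin N))).exists_dist_lt x hh
      exact Set.mem_iUnion.2 ⟨i, hi⟩
  refine ⟨t.sup id, fun x hx => ?_⟩
  obtain ⟨i, hi, hxi⟩ := Set.mem_iUnion₂.1 (ht (ball_subset_closedBall hx))
  have h1 := SimpleFunc.edist_nearestPt_le e x (Finset.le_sup (f := id) hi)
  rw [edist_dist, edist_dist, ENNReal.ofReal_le_ofReal_iff dist_nonneg] at h1
  have h2 : SimpleFunc.nearestPt e (t.sup id) x =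
      e (SimpleFunc.nearestPtInd e (t.sup id) x) := rfl
  rw [dist_comm, ← h2]
  rw [mem_ball, dist_comm] at hxi
  exact h1.trans hxi.le

lemma lintegral_abs_sub_triangle {α : Type*} [MeasurableSpace α] {μ : Measure α} {f g : α → ℝ}
    (hf : Measurable f) (hg : Measurable g) (h : α → ℝ) :
    ∫⁻ x, ENNReal.ofReal |f x - h x| ∂μ ≤
      ∫⁻ x, ENNReal.ofReal |f x - g x| ∂μ + ∫⁻ x, ENNReal.ofReal |g x - h x| ∂μ := by
  have hm : Measurable fun x => ENNReal.ofReal |f x - g x| := by fun_prop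
  rw [← lintegral_add_left hm]
  refine lintegral_mono fun x => ?_
  rw [← ENNReal.ofReal_add (abs_nonneg _) (abs_nonneg _)]
  exact ENNReal.ofReal_le_ofReal (abs_sub_le _ _ _)

/-- Completeness of `L¹` for sequences of real functions which are eventually close to some
function at each scale. -/
lemma exists_tendsto_lintegral_abs_sub {α : Type*} [MeasurableSpace α] {μ : Measure α}
    {f : ℕ → α → ℝ} (hf : ∀ n, Measurable (f n)) (hfi : ∀ n, Integrable (f n) μ)
    (h : ∀ ε : ℝ≥0∞, 0 < ε → ∃ w : α → ℝ, Measurable w ∧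
      ∀ᶠ n in atTop, ∫⁻ x, ENNReal.ofReal |f n x - w x| ∂μ ≤ ε) :
    ∃ v : α → ℝ, Measurable v ∧
      Tendsto (fun n => ∫⁻ x, ENNReal.ofReal |f n x - v x| ∂μ) atTop (nhds 0) := by
  have hmem : ∀ n, MemLp (f n) 1 μ := fun n => memLp_one_iff_integrable.2 (hfi n)
  have hc : CauchySeq fun n => (hmem n).toLp (f n) := by
    rw [EMetric.cauchySeq_iff]
    intro ε hε
    obtain ⟨δ, hδ, hδε⟩ := ENNReal.lt_iff_exists_nnreal_btwn.1 hε
    obtain ⟨w, hw, hev⟩ := h (δ / 2) (ENNReal.half_pos hδ.ne')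
    obtain ⟨n₀, hn₀⟩ := eventually_atTop.1 hev
    refine ⟨n₀, fun m hm n hn => lt_of_le_of_lt ?_ hδε⟩
    rw [Lp.edist_toLp_toLp, eLpNorm_one_eq_lintegral_enorm, ← ENNReal.add_halves (δ : ℝ≥0∞)]
    simp only [Pi.sub_apply, Real.enorm_eq_ofReal_abs]
    refine (lintegral_abs_sub_triangle (hf m) hw (f n)).trans (add_le_add (hn₀ m hm) ?_)
    simp_rw [abs_sub_comm (w _)]
    exact hn₀ n hn
  obtain ⟨g, hg⟩ := cauchySeq_tendsto_of_complete hc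
  refine ⟨g, (Lp.stronglyMeasurable g).measurable, ?_⟩
  rw [tendsto_iff_edist_tendsto_0] at hg
  refine hg.congr fun n => ?_
  conv_lhs => rw [← Lp.toLp_coeFn g (Lp.memLp g)]
  rw [Lp.edist_toLp_toLp, eLpNorm_one_eq_lintegral_enorm]
  simp only [Pi.sub_apply, Real.enorm_eq_ofReal_abs]

/-- Local compactness in `L¹` of sequences with bounded Gagliardo modular. -/
lemma exists_subseq_tendsto_lintegral_abs_sub (hs : 0 < s) (hp : ∀ x y, 1 ≤ p x y)
    {u : ℕ → EuclideanSpace ℝ (Fin N) → ℝ} (hum : ∀ n, Measurable (u n)) {K : ℝ≥0∞} (hK : K ≠ ⊤)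
    (hG : ∀ n, gagMod Set.univ s p (u n) ≤ K)
    {L : EuclideanSpace ℝ (Fin N) → ℝ → ℝ} (hL0 : ∀ x h, 0 ≤ L x h)
    (hL : ∀ n x h, ∫⁻ y in ball x h, ENNReal.ofReal |u n y| ≤ ENNReal.ofReal (L x h))
    (c : EuclideanSpace ℝ (Fin N)) (ρ : ℝ) :
    ∃ φ : ℕ → ℕ, StrictMono φ ∧ ∃ v : EuclideanSpace ℝ (Fin N) → ℝ, Measurable v ∧
      Tendsto (fun k => ∫⁻ x in ball c ρ, ENNReal.ofReal |u (φ k) x - v x|) atTop (nhds 0) := by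
  set e := TopologicalSpace.denseSeq (EuclideanSpace ℝ (Fin N)) with he
  have hui : ∀ n x h, IntegrableOn (u n) (ball x h) := fun n x h => by
    refine ⟨(hum n).aestronglyMeasurable, ?_⟩
    rw [hasFiniteIntegral_iff_norm]
    exact (hL n x h).trans_lt ENNReal.ofReal_lt_top
  set M : ℕ × ℕ → ℝ := fun i => L (e i.1) (1 / (i.2 + 1 : ℝ)) /
    (volume (ball (e i.1) (1 / (i.2 + 1 : ℝ)))).toReal
  set a : ℕ → ℕ × ℕ → ℝ := fun n i => ⨍ y in ball (e i.1) (1 / (i.2 + 1 : ℝ)), u n y with ha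
  obtain ⟨b, -, φ, hφ, hb⟩ := (isCompact_univ_pi fun i : ℕ × ℕ =>
    isCompact_Icc (a := -M i) (b := M i)).tendsto_subseq (x := a) fun n i _ =>
      abs_le.1 (abs_average_le (hL0 _ _) (hL n _ _))
  rw [tendsto_pi_nhds] at hb
  refine ⟨φ, hφ, exists_tendsto_lintegral_abs_sub (fun n => hum _) (fun n => hui _ _ _) ?_⟩
  intro ε hε
  set C₀ := ENNReal.ofReal (1 + 2 ^ s) * volume (ball c ρ) +
        ENNReal.ofReal (2 ^ (s + N) / unitBallVol N) * K with hC₀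
  have hC₀t : C₀ ≠ ⊤ := ENNReal.add_ne_top.2
    ⟨ENNReal.mul_ne_top ENNReal.ofReal_ne_top measure_ball_lt_top.ne,
      ENNReal.mul_ne_top ENNReal.ofReal_ne_top hK⟩
  have hlim : Tendsto (fun m : ℕ => ENNReal.ofReal ((1 / (m + 1 : ℝ)) ^ s) * C₀) atTop
      (nhds 0) := by
    have h1 : Tendsto (fun m : ℕ => (1 / (m + 1 : ℝ)) ^ s) atTop (nhds 0) := by
      have := (tendsto_one_div_add_atTop_nhds_zero_nat (𝕜 := ℝ)).rpow_const (p := s)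
        (Or.inr hs.le)
      rwa [Real.zero_rpow hs.ne'] at this
    have h2 := ENNReal.Tendsto.mul_const (ENNReal.tendsto_ofReal h1) (Or.inr hC₀t)
    rwa [ENNReal.ofReal_zero, zero_mul] at h2
  obtain ⟨m, hm⟩ := (hlim.eventually_lt_const (ENNReal.half_pos hε.ne')).exists
  have hh : (0 : ℝ) < 1 / (m + 1 : ℝ) := by positivity
  obtain ⟨n₀, hn₀⟩ := exists_nearestPtInd_dist_lt c ρ hh
  rw [← he] at hn₀
  set ι := SimpleFunc.nearestPtInd e n₀ with hι
  have hD : Tendsto (fun k => ENNReal.ofReal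
      (∑ i ∈ Finset.range (n₀ + 1), |a (φ k) (i, m) - b (i, m)|) * volume (ball c ρ))
      atTop (nhds 0) := by
    have h1 : Tendsto (fun k => ∑ i ∈ Finset.range (n₀ + 1), |a (φ k) (i, m) - b (i, m)|)
        atTop (nhds (∑ i ∈ Finset.range (n₀ + 1), 0)) := by
      refine tendsto_finsetSum _ fun i _ => ?_
      simpa using ((hb (i, m)).sub_const (b (i, m))).abs
    rw [Finset.sum_const_zero] at h1
    have h2 := ENNReal.Tendsto.mul_const (b := volume (ball c ρ)) (ENNReal.tendsto_ofReal h1)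
      (Or.inr measure_ball_lt_top.ne)
    rwa [ENNReal.ofReal_zero, zero_mul] at h2
  have hιm : ∀ f : ℕ → ℝ, Measurable fun x => f (ι x) := fun f =>
    (measurable_from_top (f := f)).comp ι.measurable
  refine ⟨fun x => b (ι x, m), hιm fun i => b (i, m), ?_⟩
  filter_upwards [hD.eventually_lt_const (ENNReal.half_pos hε.ne')] with k hk
  have h1 := lintegral_abs_sub_average_le (s := s) hs.le hp (hui (φ k)) measurableSet_ball hh hn₀
  have h2 : ∫⁻ x in ball c ρ, ENNReal.ofReal |u (φ k) x - a (φ k) (ι x, m)| ≤ ε / 2 := by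
    refine h1.trans (le_trans ?_ hm.le)
    rw [hC₀]
    gcongr
    exact hG _
  have h3 : ∫⁻ x in ball c ρ, ENNReal.ofReal |a (φ k) (ι x, m) - b (ι x, m)| ≤ ε / 2 := by
    refine le_trans ?_ hk.le
    rw [← setLIntegral_const]
    refine lintegral_mono fun x => ENNReal.ofReal_le_ofReal ?_
    exact Finset.single_le_sum (f := fun i => |a (φ k) (i, m) - b (i, m)|)
      (fun _ _ => abs_nonneg _)
      (Finset.mem_range.2 (Nat.lt_succ_of_le (SimpleFunc.nearestPtInd_le e n₀ x)))
  rw [← ENNReal.add_halves ε]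
  exact (lintegral_abs_sub_triangle (hum _) (hιm fun i => a (φ k) (i, m)) _).trans
    (add_le_add h2 h3)

end Compactness

lemma rpow_le_mul_add_mul_rpow {x T r R q : ℝ} (hx : 0 ≤ x) (hT : 1 ≤ T) (hr : 1 ≤ r)
    (hrR : r ≤ R) (hRq : R ≤ q) : x ^ r ≤ T ^ R * x + T ^ (R - q) * x ^ q := by
  have hT0 : 0 < T := zero_lt_one.trans_le hT
  rcases hx.eq_or_lt with rfl | hx0
  · rw [Real.zero_rpow (by positivity)]; positivity
  rcases le_total x T with h | h
  · have h1 : x ^ (r - 1) ≤ T ^ R := (Real.rpow_le_rpow hx h (by linarith)).trans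
      (Real.rpow_le_rpow_of_exponent_le hT (by linarith))
    calc x ^ r = x ^ (r - 1) * x := by rw [Real.rpow_sub_one hx0.ne']; field_simp
      _ ≤ T ^ R * x := by gcongr
      _ ≤ _ := le_add_of_nonneg_right (by positivity)
  · have h1 : x ^ (R - q) ≤ T ^ (R - q) := Real.rpow_le_rpow_of_nonpos hT0 h (by linarith)
    calc x ^ r ≤ x ^ R := Real.rpow_le_rpow_of_exponent_le (hT.trans h) hrR
      _ = x ^ (R - q) * x ^ q := by rw [← Real.rpow_add hx0]; congr 1; ring
      _ ≤ T ^ (R - q) * x ^ q := by gcongr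
      _ ≤ _ := le_add_of_nonneg_left (by positivity)

lemma abs_sub_div_rpow_le {a b ε q : ℝ} (hε : 0 < ε) (hq : 0 ≤ q) :
    |(a - b) / ε| ^ q ≤ (2 / ε) ^ q * (|a| ^ q + |b| ^ q) := by
  have h : |(a - b) / ε| ≤ 2 / ε * max |a| |b| := by
    rw [abs_div, abs_of_pos hε, div_mul_eq_mul_div]
    gcongr
    have := abs_sub a b
    have := le_max_left |a| |b|
    have := le_max_right |a| |b|
    linarith
  refine (Real.rpow_le_rpow (abs_nonneg _) h hq).trans ?_
  rw [Real.mul_rpow (by positivity) (le_max_of_le_left (abs_nonneg _))]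
  gcongr
  rcases max_choice |a| |b| with h | h <;> rw [h]
  · exact le_add_of_nonneg_right (by positivity)
  · exact le_add_of_nonneg_left (by positivity)

section Interpolation

variable {α : Type*} [MeasurableSpace α] {μ : Measure α} {f : ℕ → α → ℝ} {v : α → ℝ}

/-- Fatou's lemma along an `L¹`-convergent sequence. -/
lemma lintegral_abs_rpow_le_of_tendsto (hf : ∀ n, Measurable (f n)) (hv : Measurable v)
    (hfv : Tendsto (fun n => ∫⁻ x, ENNReal.ofReal |f n x - v x| ∂μ) atTop (nhds 0))
    {q : ℝ} (hq : 0 ≤ q) {C : ℝ≥0∞}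
    (hC : ∀ n, ∫⁻ x, ENNReal.ofReal (|f n x| ^ q) ∂μ ≤ C) :
    ∫⁻ x, ENNReal.ofReal (|v x| ^ q) ∂μ ≤ C := by
  have h1 : TendstoInMeasure μ f atTop v := by
    refine tendstoInMeasure_of_tendsto_eLpNorm one_ne_zero
      (fun n => (hf n).aestronglyMeasurable) hv.aestronglyMeasurable (hfv.congr fun n => ?_)
    rw [eLpNorm_one_eq_lintegral_enorm]
    simp only [Pi.sub_apply, Real.enorm_eq_ofReal_abs]
  obtain ⟨ns, -, hns⟩ := h1.exists_seq_tendsto_ae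
  calc ∫⁻ x, ENNReal.ofReal (|v x| ^ q) ∂μ
      = ∫⁻ x, liminf (fun i => ENNReal.ofReal (|f (ns i) x| ^ q)) atTop ∂μ := by
        refine lintegral_congr_ae ?_
        filter_upwards [hns] with x hx
        exact (ENNReal.tendsto_ofReal (hx.abs.rpow_const (Or.inr hq))).liminf_eq.symm
    _ ≤ liminf (fun i => ∫⁻ x, ENNReal.ofReal (|f (ns i) x| ^ q) ∂μ) atTop :=
        lintegral_liminf_le fun i => ((hf _).abs.pow_const q).ennreal_ofReal
    _ ≤ C := by
        refine (liminf_le_liminf (Eventually.of_forall fun i => hC (ns i))).trans ?_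
        simp

/-- `L¹` convergence together with an `L^q` bound gives convergence of modulars with exponents
staying below `q`. -/
lemma tendsto_lintegral_rpow_of_lt (hf : ∀ n, Measurable (f n)) (hv : Measurable v)
    (hfv : Tendsto (fun n => ∫⁻ x, ENNReal.ofReal |f n x - v x| ∂μ) atTop (nhds 0))
    {q R : ℝ} (hR : 1 ≤ R) (hRq : R < q) {C : ℝ≥0∞} (hCt : C ≠ ⊤)
    (hC : ∀ n, ∫⁻ x, ENNReal.ofReal (|f n x| ^ q) ∂μ ≤ C)
    {r : α → ℝ} (hr : ∀ᵐ x ∂μ, 1 ≤ r x ∧ r x ≤ R) {ε : ℝ} (hε : 0 < ε) :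
    Tendsto (fun n => ∫⁻ x, ENNReal.ofReal (|(f n x - v x) / ε| ^ r x) ∂μ) atTop (nhds 0) := by
  have hq : 0 ≤ q := by linarith
  have hvC := lintegral_abs_rpow_le_of_tendsto hf hv hfv hq hC
  set C' := ENNReal.ofReal ((2 / ε) ^ q) * (C + C) with hC'
  have hC't : C' ≠ ⊤ := ENNReal.mul_ne_top ENNReal.ofReal_ne_top (ENNReal.add_ne_top.2 ⟨hCt, hCt⟩)
  have hqb : ∀ n, ∫⁻ x, ENNReal.ofReal (|(f n x - v x) / ε| ^ q) ∂μ ≤ C' := fun n => by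
    have hm : Measurable fun x => ENNReal.ofReal (|f n x| ^ q) :=
      ((hf n).abs.pow_const q).ennreal_ofReal
    refine le_trans ?_ (mul_le_mul_right (add_le_add (hC n) hvC) _)
    rw [← lintegral_add_left hm, ← lintegral_const_mul' _ _ ENNReal.ofReal_ne_top]
    refine lintegral_mono fun x => ?_
    rw [← ENNReal.ofReal_add (by positivity) (by positivity), ← ENNReal.ofReal_mul (by positivity)]
    exact ENNReal.ofReal_le_ofReal (abs_sub_div_rpow_le hε hq)
  have hb : ∀ T : ℝ, 1 ≤ T → ∀ n, ∫⁻ x, ENNReal.ofReal (|(f n x - v x) / ε| ^ r x) ∂μ ≤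
      ENNReal.ofReal (T ^ R / ε) * ∫⁻ x, ENNReal.ofReal |f n x - v x| ∂μ +
        ENNReal.ofReal (T ^ (R - q)) * C' := fun T hT n => by
    refine le_trans ?_ (add_le_add le_rfl (mul_le_mul_right (hqb n) _))
    have hm : Measurable fun x => ENNReal.ofReal (T ^ R / ε) * ENNReal.ofReal |f n x - v x| :=
      ((hf n).sub hv).abs.ennreal_ofReal.const_mul _
    rw [← lintegral_const_mul' _ _ ENNReal.ofReal_ne_top,
      ← lintegral_const_mul' _ _ ENNReal.ofReal_ne_top, ← lintegral_add_left hm]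
    refine lintegral_mono_ae ?_
    filter_upwards [hr] with x hx
    rw [← ENNReal.ofReal_mul (by positivity), ← ENNReal.ofReal_mul (by positivity),
      ← ENNReal.ofReal_add (by positivity) (by positivity)]
    refine ENNReal.ofReal_le_ofReal
      ((rpow_le_mul_add_mul_rpow (abs_nonneg _) hT hx.1 hx.2 hRq.le).trans (le_of_eq ?_))
    congr 1
    rw [abs_div, abs_of_pos hε]
    ring
  rw [ENNReal.tendsto_nhds_zero]
  intro η hη
  have hTlim : Tendsto (fun T : ℝ => ENNReal.ofReal (T ^ (R - q)) * C') atTop (nhds 0) := by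
    have h1 := tendsto_rpow_neg_atTop (show 0 < q - R by linarith)
    rw [neg_sub] at h1
    have h2 := ENNReal.Tendsto.mul_const (ENNReal.tendsto_ofReal h1) (Or.inr hC't)
    rwa [ENNReal.ofReal_zero, zero_mul] at h2
  obtain ⟨T, hT, hT1⟩ := ((hTlim.eventually_lt_const (ENNReal.half_pos hη.ne')).and
    (eventually_ge_atTop 1)).exists
  have hlim : Tendsto (fun n => ENNReal.ofReal (T ^ R / ε) *
      ∫⁻ x, ENNReal.ofReal |f n x - v x| ∂μ) atTop (nhds 0) := by
    have h2 := ENNReal.Tendsto.const_mul (a := ENNReal.ofReal (T ^ R / ε)) hfv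
      (Or.inr ENNReal.ofReal_ne_top)
    rwa [mul_zero] at h2
  filter_upwards [hlim.eventually_lt_const (ENNReal.half_pos hη.ne')] with n hn
  refine (hb T hT1 n).trans ?_
  rw [← ENNReal.add_halves η]
  exact add_le_add hn.le hT.le

end Interpolation

/-- Near every point the exponent `p` stays above some `t` whose critical exponent still exceeds
a bound `R` for `r` near that point. -/
lemma exists_local_exponents {N : ℕ} {s : ℝ} (hs : 0 ≤ s)
    {p : EuclideanSpace ℝ (Fin N) → EuclideanSpace ℝ (Fin N) → ℝ}
    (hp : Continuous fun z : EuclideanSpace ℝ (Fin N) × EuclideanSpace ℝ (Fin N) => p z.1 z.2)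
    {r : EuclideanSpace ℝ (Fin N) → ℝ} (hr : Continuous r) (x₀ : EuclideanSpace ℝ (Fin N))
    (hp1 : 1 < p x₀ x₀) (hpN : s * p x₀ x₀ < N)
    (hsub : r x₀ < N * p x₀ x₀ / (N - s * p x₀ x₀)) :
    ∃ t R h₀ : ℝ, 1 ≤ t ∧ s * t < N ∧ R < N * t / (N - s * t) ∧ 0 < h₀ ∧ h₀ ≤ 1 ∧
      (∀ x ∈ ball x₀ (2 * h₀), ∀ y ∈ ball x₀ (2 * h₀), t ≤ p x y) ∧
      ∀ x ∈ ball x₀ h₀, r x ≤ R := by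
  have hd : N - s * p x₀ x₀ ≠ 0 := by linarith
  have hc : ContinuousAt (fun t : ℝ => N * t / (N - s * t)) (p x₀ x₀) := by
    fun_prop (disch := exact hd)
  have hev : ∀ᶠ t in nhdsWithin (p x₀ x₀) (Set.Iio (p x₀ x₀)),
      r x₀ < N * t / (N - s * t) ∧ 1 < t :=
    nhdsWithin_le_nhds ((hc.eventually_const_lt hsub).and (lt_mem_nhds hp1))
  obtain ⟨t, ⟨ht, ht1⟩, htp⟩ := (hev.and self_mem_nhdsWithin).exists
  obtain ⟨R, hrR, hRq⟩ := exists_between ht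
  have h1 : ∀ᶠ z in nhds (x₀, x₀), t < p z.1 z.2 := hp.continuousAt.eventually_const_lt htp
  obtain ⟨δ₁, hδ₁, hb₁⟩ := Metric.eventually_nhds_iff_ball.1 h1
  obtain ⟨δ₂, hδ₂, hb₂⟩ := Metric.eventually_nhds_iff_ball.1
    (hr.continuousAt.eventually_lt_const hrR)
  refine ⟨t, R, min 1 (min (δ₁ / 2) δ₂), ht1.le,
    lt_of_le_of_lt (mul_le_mul_of_nonneg_left htp.le hs) hpN, hRq, by positivity,
    min_le_left _ _, fun x hx y hy => ?_, fun x hx => ?_⟩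
  · have h2 : 2 * min 1 (min (δ₁ / 2) δ₂) ≤ δ₁ := by
      have := (min_le_right 1 (min (δ₁ / 2) δ₂)).trans (min_le_left _ _)
      linarith
    refine (hb₁ (x, y) ?_).le
    rw [← ball_prod_same]
    exact ⟨ball_subset_ball h2 hx, ball_subset_ball h2 hy⟩
  · exact (hb₂ x (ball_subset_ball ((min_le_right _ _).trans (min_le_right _ _)) hx)).le

/-- **Theorem 3.7 (ii): compact local embedding on `ℝ^N`.** Let `s ∈ (0,1)` and `p` be a
uniformly continuous symmetric exponent on `ℝ^N × ℝ^N` with `1 < p⁻ ≤ p⁺ < ∞` and `s p⁺ < N`.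
Then for every continuous `r` with `1 < inf r ≤ sup r < ∞` and `r(x) < N p(x,x)/(N − s p(x,x))`
everywhere, `W^{s,p(·,·)}(ℝ^N) ↪↪ L^{r(·)}_loc(ℝ^N)`: on every ball, every bounded sequence has
a subsequence converging in the `L^{r(·)}` norm of the ball. -/
theorem stmt_3 {N : ℕ}
    (s : ℝ) (hs0 : 0 < s) (hs1 : s < 1)
    (p : EuclideanSpace ℝ (Fin N) → EuclideanSpace ℝ (Fin N) → ℝ)
    (hp_uc : UniformContinuous
      (fun z : EuclideanSpace ℝ (Fin N) × EuclideanSpace ℝ (Fin N) => p z.1 z.2))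
    (hp_symm : ∀ x y, p x y = p y x)
    (pm pM : ℝ)
    (hpm : pm = sInf (Set.range
      fun z : EuclideanSpace ℝ (Fin N) × EuclideanSpace ℝ (Fin N) => p z.1 z.2))
    (hpM : pM = sSup (Set.range
      fun z : EuclideanSpace ℝ (Fin N) × EuclideanSpace ℝ (Fin N) => p z.1 z.2))
    (hp_lb : 1 < pm)
    (hp_bddAbove : BddAbove (Set.range
      fun z : EuclideanSpace ℝ (Fin N) × EuclideanSpace ℝ (Fin N) => p z.1 z.2))
    (hp_ub : s * pM < N)
    (r : EuclideanSpace ℝ (Fin N) → ℝ) (hr_cont : Continuous r)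
    (hr_lb : 1 < sInf (Set.range r)) (hr_bddAbove : BddAbove (Set.range r))
    (hr_sub : ∀ x, r x < N * p x x / (N - s * p x x)) :
    ∀ c : EuclideanSpace ℝ (Fin N), ∀ ρ : ℝ, 0 < ρ →
      ∀ u : ℕ → EuclideanSpace ℝ (Fin N) → ℝ,
        (∀ n, memW Set.univ (fun x => p x x) s p (u n)) →
        (∃ M : ℝ, ∀ n, sobNorm Set.univ (fun x => p x x) s p (u n) ≤ M) →
        ∃ φ : ℕ → ℕ, StrictMono φ ∧ ∃ v : EuclideanSpace ℝ (Fin N) → ℝ, Measurable v ∧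
          Tendsto (fun k => luxNorm (Metric.ball c ρ) r (fun x => u (φ k) x - v x))
            atTop (nhds 0) := by
  intro c ρ hρ u hu ⟨M, hM⟩
  have hp_low : BddBelow (Set.range
      fun z : EuclideanSpace ℝ (Fin N) × EuclideanSpace ℝ (Fin N) => p z.1 z.2) := by
    by_contra h
    rw [hpm, Real.sInf_of_not_bddBelow h] at hp_lb
    linarith
  have hp1 : ∀ x y, 1 < p x y := fun x y =>
    hp_lb.trans_le (hpm ▸ csInf_le hp_low ⟨(x, y), rfl⟩)
  have hpM' : ∀ x y, p x y ≤ pM := fun x y => hpM ▸ le_csSup hp_bddAbove ⟨(x, y), rfl⟩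
  have hr_low : BddBelow (Set.range r) := by
    by_contra h
    rw [Real.sInf_of_not_bddBelow h] at hr_lb
    linarith
  have hr1 : ∀ x, 1 < r x := fun x => hr_lb.trans_le (csInf_le hr_low ⟨x, rfl⟩)
  have hum : ∀ n, Measurable (u n) := fun n => (hu n).1
  set A := max 1 (M + 1) with hA
  have hA1 : 1 ≤ A := le_max_left _ _
  set K := A ^ pM with hK
  have hK0 : 0 ≤ K := by positivity
  have hmod : ∀ n, modLq Set.univ (fun x => p x x) (u n) ≤ ENNReal.ofReal K := fun n => by
    refine modLq_le_of_luxNorm_lt (fun x => (hp1 x x).le) (fun x => hpM' x x) hA1 (hu n).2.1 ?_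
    have h1 := hM n
    have h2 := gagSeminorm_nonneg (Ω := Set.univ) (s := s) (p := p) (u := u n)
    have h3 := le_max_right 1 (M + 1)
    unfold sobNorm at h1
    linarith
  have hgag : ∀ n, gagMod Set.univ s p (u n) ≤ ENNReal.ofReal K := fun n => by
    refine gagMod_le_of_gagSeminorm_lt (fun x y => (hp1 x y).le) hpM' hA1 (hu n).2.2 ?_
    have h1 := hM n
    have h2 := luxNorm_nonneg (Ω := Set.univ) (q := fun x => p x x) (u := u n)
    have h3 := le_max_right 1 (M + 1)
    unfold sobNorm at h1
    linarith
  have hL : ∀ n x h, ∫⁻ y in ball x h, ENNReal.ofReal |u n y| ≤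
      ENNReal.ofReal ((volume (ball x h)).toReal + K) := fun n x h => by
    rw [ENNReal.ofReal_add ENNReal.toReal_nonneg hK0,
      ENNReal.ofReal_toReal measure_ball_lt_top.ne]
    exact (lintegral_abs_le_volume_add_modLq (fun x => (hp1 x x).le) _).trans
      (add_le_add le_rfl (hmod n))
  obtain ⟨φ, hφ, v, hv, hlim⟩ := exists_subseq_tendsto_lintegral_abs_sub hs0
    (fun x y => (hp1 x y).le) hum ENNReal.ofReal_ne_top hgag (fun x h => by positivity) hL c ρ
  refine ⟨φ, hφ, v, hv, ?_⟩
  have hmain : ∀ ε : ℝ, 0 < ε → Tendsto (fun k => ∫⁻ x in closedBall c ρ ∩ ball c ρ,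
      ENNReal.ofReal (|(u (φ k) x - v x) / ε| ^ r x)) atTop (nhds 0) := fun ε hε => by
    refine (isCompact_closedBall c ρ).induction_on
      (p := fun S => Tendsto (fun k => ∫⁻ x in S ∩ ball c ρ,
        ENNReal.ofReal (|(u (φ k) x - v x) / ε| ^ r x)) atTop (nhds 0)) ?_ ?_ ?_ ?_
    · simp
    · intro S T hST hT
      exact tendsto_of_tendsto_of_tendsto_of_le_of_le tendsto_const_nhds hT (fun _ => zero_le)
        fun k => lintegral_mono_set (Set.inter_subset_inter_left _ hST)
    · intro S T hS hT
      have h := hS.add hT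
      rw [add_zero] at h
      refine tendsto_of_tendsto_of_tendsto_of_le_of_le tendsto_const_nhds h (fun _ => zero_le)
        fun k => ?_
      simp only [Set.union_inter_distrib_right]
      exact lintegral_union_le _ _ _
    · intro x₀ _
      obtain ⟨t, R, h₀, ht, hst, hRq, h₀0, h₀1, htp, hrR⟩ := exists_local_exponents hs0.le
        hp_uc.continuous hr_cont x₀ (hp1 x₀ x₀)
        (lt_of_le_of_lt (mul_le_mul_of_nonneg_left (hpM' x₀ x₀) hs0.le) hp_ub) (hr_sub x₀)
      obtain ⟨C, hCt, hC⟩ := exists_lintegral_rpow_le (p := p) (x₀ := x₀) hs0.le ht hst h₀0 h₀1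
        htp hK0 (L := (volume (ball x₀ (2 * h₀))).toReal + K) (by positivity)
      refine ⟨ball x₀ h₀, mem_nhdsWithin_of_mem_nhds (ball_mem_nhds x₀ h₀0), ?_⟩
      refine tendsto_lintegral_rpow_of_lt (fun k => hum (φ k)) hv ?_
        ((hr1 x₀).le.trans (hrR x₀ (mem_ball_self h₀0))) hRq hCt (fun k => ?_) ?_ hε
      · exact tendsto_of_tendsto_of_tendsto_of_le_of_le tendsto_const_nhds hlim (fun _ => zero_le)
          fun k => lintegral_mono_set Set.inter_subset_right
      · exact (lintegral_mono_set Set.inter_subset_left).trans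
          (hC (u (φ k)) (hum _) (hgag _) (hL _ _ _))
      · filter_upwards [ae_restrict_mem (measurableSet_ball.inter measurableSet_ball)] with x hx
        exact ⟨(hr1 x).le, hrR x hx.1⟩
  rw [Metric.tendsto_atTop']
  intro ε hε
  obtain ⟨k₀, hk₀⟩ := eventually_atTop.1
    ((hmain (ε / 2) (half_pos hε)).eventually_le_const zero_lt_one)
  refine ⟨k₀, fun k hk => ?_⟩
  have h1 := hk₀ k hk.le
  rw [Set.inter_eq_self_of_subset_right ball_subset_closedBall] at h1
  rw [Real.dist_0_eq_abs, abs_of_nonneg luxNorm_nonneg]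
  have h2 : luxNorm (ball c ρ) r (fun x => u (φ k) x - v x) ≤ ε / 2 :=
    csInf_le ⟨0, fun _ h => h.1.le⟩ ⟨half_pos hε, h1⟩
  linarith
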